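/- arXiv:0904.0441 — 2 statements merged into one kernel-verified Lean document; each statement's English description precedes it below -/
import Mathlib

section
/- Let q be an odd prime power, n ≥ 2, and λ ∈ F_q*. If A, B ⊆ F_{q^n} satisfy |A||B| ≥ q^{n+2}, then there exist X ∈ A and Y ∈ B with N(X + Y) = λ, where N is the norm map from F_{q^n} to F_q. -/
open Finset

noncomputable def hatF {K : Type} [Field K] (ψ : AddChar K ℂ) (T : Finset K) (a : K) : ℂ :=
  ∑ t ∈ T, ψ (t * a)

lemma hat_conj {K : Type} [Field K] [Fintype K] (ψ : AddChar K ℂ) (T : Finset K) (a : K) :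
    (starRingEnd ℂ) (hatF ψ T a) = ∑ t ∈ T, ψ (-t * a) := by
  unfold hatF
  rw [map_sum]
  refine Finset.sum_congr rfl fun t _ => ?_
  rw [neg_mul, AddChar.map_neg_eq_conj]

lemma hat_parseval {K : Type} [Field K] [Fintype K] [DecidableEq K] (ψ : AddChar K ℂ)
    (hψ : ψ.IsPrimitive) (T : Finset K) :
    ∑ a, ‖hatF ψ T a‖ ^ 2 = (Fintype.card K : ℝ) * T.card := by
  have h : ((∑ a, ‖hatF ψ T a‖ ^ 2 : ℝ) : ℂ) = (Fintype.card K : ℂ) * T.card := by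
    push_cast
    calc ∑ a, (‖hatF ψ T a‖ : ℂ) ^ 2 = ∑ a, ∑ t ∈ T, ∑ s ∈ T, ψ (a * (t - s)) := by
          refine Finset.sum_congr rfl fun a _ => ?_
          rw [← Complex.mul_conj', hat_conj, hatF, Finset.sum_mul_sum]
          refine Finset.sum_congr rfl fun t _ => Finset.sum_congr rfl fun s _ => ?_
          rw [← AddChar.map_add_eq_mul]
          congr 1; ring
      _ = ∑ t ∈ T, ∑ s ∈ T, ∑ a, ψ (a * (t - s)) := by
          rw [Finset.sum_comm]
          refine Finset.sum_congr rfl fun t _ => Finset.sum_comm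
      _ = ∑ t ∈ T, (Fintype.card K : ℂ) := by
          refine Finset.sum_congr rfl fun t ht => ?_
          simp_rw [AddChar.sum_mulShift _ hψ, sub_eq_zero]
          simp [ht]
      _ = _ := by simp [mul_comm]
  exact_mod_cast h

lemma hat_count {K : Type} [Field K] [Fintype K] [DecidableEq K] (ψ : AddChar K ℂ)
    (hψ : ψ.IsPrimitive) (A B S : Finset K) (h : ∀ x ∈ A, ∀ y ∈ B, x + y ∉ S) :
    ∑ a, hatF ψ A a * hatF ψ B a * (starRingEnd ℂ) (hatF ψ S a) = 0 := by
  calc _ = ∑ a, ∑ x ∈ A, ∑ y ∈ B, ∑ s ∈ S, ψ (a * (x + y - s)) := by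
          refine Finset.sum_congr rfl fun a _ => ?_
          rw [hat_conj, hatF, hatF, Finset.sum_mul_sum, Finset.sum_mul]
          refine Finset.sum_congr rfl fun x _ => ?_
          rw [Finset.sum_mul_sum]
          refine Finset.sum_congr rfl fun y _ => Finset.sum_congr rfl fun s _ => ?_
          rw [← AddChar.map_add_eq_mul, ← AddChar.map_add_eq_mul]
          congr 1; ring
    _ = ∑ x ∈ A, ∑ y ∈ B, ∑ s ∈ S, ∑ a, ψ (a * (x + y - s)) := by
          rw [Finset.sum_comm]
          refine Finset.sum_congr rfl fun x _ => ?_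
          rw [Finset.sum_comm]
          exact Finset.sum_congr rfl fun y _ => Finset.sum_comm
    _ = 0 := by
          refine Finset.sum_eq_zero fun x hx => Finset.sum_eq_zero fun y hy =>
            Finset.sum_eq_zero fun s hs => ?_
          rw [AddChar.sum_mulShift _ hψ, if_neg, Nat.cast_zero]
          intro h0
          exact h x hx y hy (by rwa [sub_eq_zero.1 h0])

/-- main inequality -/
lemma main_ineq {K : Type} [Field K] [Fintype K] [DecidableEq K] (ψ : AddChar K ℂ)
    (hψ : ψ.IsPrimitive) (A B S : Finset K) (h : ∀ x ∈ A, ∀ y ∈ B, x + y ∉ S)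
    (hS : ∀ a, a ≠ 0 → ‖hatF ψ S a‖ ^ 2 ≤ Fintype.card K) :
    ((A.card : ℝ) * B.card * S.card) ^ 2 ≤ (Fintype.card K : ℝ) ^ 3 * (A.card * B.card) := by
  have h0 := hat_count ψ hψ A B S h
  rw [← Finset.add_sum_erase _ _ (mem_univ (0 : K))] at h0
  have hz : ∀ T : Finset K, hatF ψ T 0 = T.card := fun T => by simp [hatF]
  simp only [hz, map_natCast] at h0
  set Q : ℝ := (Fintype.card K : ℝ) with hQ
  have h1 : (A.card : ℝ) * B.card * S.card
      ≤ ∑ a ∈ univ.erase (0 : K), √Q * (‖hatF ψ A a‖ * ‖hatF ψ B a‖) := by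
    have : ((A.card : ℂ) * B.card * S.card) =
       - ∑ a ∈ univ.erase (0 : K), hatF ψ A a * hatF ψ B a * (starRingEnd ℂ) (hatF ψ S a) :=
      eq_neg_of_add_eq_zero_left h0
    have h2 := congrArg norm this
    rw [norm_neg] at h2
    simp only [norm_mul, Complex.norm_natCast] at h2
    rw [h2]
    refine (norm_sum_le _ _).trans (Finset.sum_le_sum fun a ha => ?_)
    rw [norm_mul, norm_mul, RCLike.norm_conj, mul_comm]
    refine mul_le_mul_of_nonneg_right (Real.le_sqrt_of_sq_le (hS a (Finset.ne_of_mem_erase ha)))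
      (by positivity)
  have h3 : (A.card : ℝ) * B.card * S.card ≤ √Q * ∑ a, ‖hatF ψ A a‖ * ‖hatF ψ B a‖ := by
    refine h1.trans ?_
    rw [← Finset.mul_sum]
    refine mul_le_mul_of_nonneg_left ?_ (Real.sqrt_nonneg _)
    exact Finset.sum_le_sum_of_subset_of_nonneg (Finset.erase_subset _ _)
      fun _ _ _ => by positivity
  have h4 := Finset.sum_mul_sq_le_sq_mul_sq univ (fun a => ‖hatF ψ A a‖) (fun a => ‖hatF ψ B a‖)
  rw [hat_parseval ψ hψ, hat_parseval ψ hψ] at h4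
  calc _ ≤ (√Q * ∑ a, ‖hatF ψ A a‖ * ‖hatF ψ B a‖) ^ 2 :=
        pow_le_pow_left₀ (by positivity) h3 2
    _ = Q * (∑ a, ‖hatF ψ A a‖ * ‖hatF ψ B a‖) ^ 2 := by
        rw [mul_pow, Real.sq_sqrt (by positivity)]
    _ ≤ Q * (Q * A.card * (Q * B.card)) := mul_le_mul_of_nonneg_left h4 (by positivity)
    _ = _ := by ring

theorem stmt4 (F K : Type) [Field F] [Field K] [Fintype F] [Fintype K]
    [DecidableEq K] [Algebra F K]
    (n : ℕ) (hn : 2 ≤ n) (hodd : Odd (Fintype.card F))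
    (hcard : Fintype.card K = Fintype.card F ^ n)
    (lam : F) (hlam : lam ≠ 0)
    (A B : Finset K)
    (hAB : Fintype.card F ^ (n + 2) ≤ A.card * B.card) :
    ∃ X ∈ A, ∃ Y ∈ B, Algebra.norm F (X + Y) = lam := by
  classical
  by_contra hcon
  push Not at hcon
  have hsurj : ∀ μ : F, ∃ x : K, Algebra.norm F x = μ := by
    exact FiniteField.norm_surjective F K
  set S : Finset K := univ.filter (fun x => Algebra.norm F x = lam) with hSdef
  have hSmem : ∀ x, x ∈ S ↔ Algebra.norm F x = lam := fun x => by simp [hSdef]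
  obtain ⟨s0, hs0⟩ := hsurj lam
  have hs00 : s0 ≠ 0 := by
    rintro rfl
    exact hlam (by rw [← hs0]; exact Algebra.norm_zero)
  have hSpos : 0 < S.card := Finset.card_pos.2 ⟨s0, (hSmem _).2 hs0⟩
  have hninv : ∀ x : K, x ≠ 0 → Algebra.norm F x⁻¹ = (Algebra.norm F x)⁻¹ := by
    intro x hx
    refine eq_inv_of_mul_eq_one_left ?_
    rw [← map_mul, inv_mul_cancel₀ hx, map_one]
  -- a primitive character
  let ψ : AddChar K ℂ := AddChar.FiniteField.primitiveChar_to_Complex K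
  have hψ : ψ.IsPrimitive := AddChar.FiniteField.primitiveChar_to_Complex_isPrimitive K
  have hinv : ∀ u : K, Algebra.norm F u = 1 → ∀ a, hatF ψ S (a * u) = hatF ψ S a := by
    intro u hu a
    have hu0 : u ≠ 0 := by
      rintro rfl
      rw [Algebra.norm_zero] at hu
      exact zero_ne_one hu
    unfold hatF
    refine Finset.sum_bij' (fun t _ => t * u) (fun t _ => t * u⁻¹) ?_ ?_ ?_ ?_ ?_
    · intro t ht
      rw [hSmem] at ht ⊢
      rw [map_mul, ht, hu, mul_one]
    · intro t ht
      rw [hSmem] at ht ⊢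
      rw [map_mul, hninv u hu0, ht, hu, inv_one, mul_one]
    · intro t _; field_simp
    · intro t _; field_simp
    · intro t _; congr 1; ring
  have hbound : ∀ a, a ≠ 0 → ‖hatF ψ S a‖ ^ 2 ≤ Fintype.card K := by
    intro a ha
    have h1 : ∑ s ∈ S, ‖hatF ψ S (a * (s * s0⁻¹))‖ ^ 2 ≤ ∑ b, ‖hatF ψ S b‖ ^ 2 := by
      rw [← Finset.sum_image (s := S) (g := fun s => a * (s * s0⁻¹))
        (f := fun b => ‖hatF ψ S b‖ ^ 2)]
      · exact Finset.sum_le_sum_of_subset_of_nonneg (Finset.subset_univ _)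
          fun _ _ _ => by positivity
      · intro s _ t _ hst
        exact mul_right_cancel₀ (inv_ne_zero hs00) (mul_left_cancel₀ ha hst)
    rw [hat_parseval ψ hψ, Finset.sum_congr rfl (g := fun _ => ‖hatF ψ S a‖ ^ 2), Finset.sum_const,
      nsmul_eq_mul, mul_comm] at h1
    · exact le_of_mul_le_mul_right h1 (by exact_mod_cast hSpos)
    · intro s hs
      rw [hinv]
      rw [map_mul, hninv s0 hs00, (hSmem _).1 hs, hs0, mul_inv_cancel₀ hlam]
  have hmain := main_ineq ψ hψ A B S
    (fun x hx y hy hxy => hcon x hx y hy ((hSmem _).1 hxy)) hbound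
  -- cardinality of the fibre
  have hfib : Fintype.card K - 1 ≤ (Fintype.card F - 1) * S.card := by
    have h1 := Finset.card_le_mul_card_image_of_maps_to (s := univ.erase (0 : K))
      (t := univ.erase (0 : F)) (f := fun x => Algebra.norm F x) (n := S.card) ?_ ?_
    · rw [Finset.card_erase_of_mem (mem_univ _), Finset.card_erase_of_mem (mem_univ _),
        Finset.card_univ, Finset.card_univ] at h1
      rwa [mul_comm]
    · intro x hx
      simpa [Algebra.norm_eq_zero_iff] using hx
    · intro μ hμ
      have hμ0 : μ ≠ 0 := Finset.ne_of_mem_erase hμ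
      obtain ⟨c, hc⟩ := hsurj (lam / μ)
      have hc0 : c ≠ 0 := by
        rintro rfl
        rw [Algebra.norm_zero] at hc
        exact div_ne_zero hlam hμ0 hc.symm
      refine Finset.card_le_card_of_injOn (fun x => c * x) ?_ ?_
      · intro x hx
        have hx' := (Finset.mem_filter.1 hx).2
        refine (hSmem _).2 ?_
        rw [map_mul, hc, hx', div_mul_cancel₀ _ hμ0]
      · intro x _ y _ hxy
        exact mul_left_cancel₀ hc0 hxy
  have hq : 2 ≤ Fintype.card F := Fintype.one_lt_card
  set q := Fintype.card F with hqdef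
  have hQ2 : q ^ 2 ≤ Fintype.card K := by
    rw [hcard]; exact Nat.pow_le_pow_right (by omega) hn
  have hbig : Fintype.card K < q * S.card := by
    obtain ⟨r, hr⟩ : ∃ r, q = r + 1 := ⟨q - 1, by omega⟩
    have hM : 2 ≤ S.card := by
      by_contra hlt
      have : S.card = 1 := by omega
      rw [this] at hfib
      have : q < q ^ 2 := by nlinarith
      omega
    rw [hr] at hfib ⊢
    simp only [Nat.add_sub_cancel] at hfib
    rw [add_mul]
    omega
  have hAB' : (Fintype.card K : ℝ) * (q : ℝ) ^ 2 ≤ (A.card : ℝ) * B.card := by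
    rw [hcard]
    rw [pow_add] at hAB
    exact_mod_cast hAB
  have hbig' : (Fintype.card K : ℝ) < q * S.card := by exact_mod_cast hbig
  have hQpos : (0 : ℝ) < Fintype.card K := by exact_mod_cast Fintype.card_pos
  have hq0 : (0 : ℝ) < q := by exact_mod_cast (by omega : 0 < q)
  generalize (Fintype.card K : ℝ) = Q at *
  generalize hP : (A.card : ℝ) * B.card = P at *
  generalize (S.card : ℝ) = M at *
  generalize (q : ℝ) = r at *
  have hPpos : 0 < P := lt_of_lt_of_le (by positivity) hAB'
  have h5 : P * M ^ 2 ≤ Q ^ 3 := by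
    refine le_of_mul_le_mul_right ?_ hPpos
    calc P * M ^ 2 * P = (P * M) ^ 2 := by ring
      _ ≤ _ := hmain
  have h6 : Q * r ^ 2 * M ^ 2 ≤ P * M ^ 2 := mul_le_mul_of_nonneg_right hAB' (sq_nonneg _)
  have h7 : Q ^ 2 < (r * M) ^ 2 := pow_lt_pow_left₀ hbig' hQpos.le (by norm_num)
  have h8 : Q * Q ^ 2 < Q * (r * M) ^ 2 := mul_lt_mul_of_pos_left h7 hQpos
  nlinarith
end

section
/- For any subset A of a finite field F_q and d ≥ 2, one has |A·A|^{d-1} |dA| ≫ min( q |A|^{d-1}, |A|^{3d-2} / q^{d-1} ), i.e., there is an absolute constant c > 0 with |A·A|^{d-1}|dA| ≥ c · min(q|A|^{d-1}, |A|^{3d-2}/q^{d-1}). -/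
open Finset

section energy
set_option linter.unusedSectionVars false
variable {F : Type} [Field F] [Fintype F] [DecidableEq F]

/-- The `k`-fold sumset. -/
def DD (A : Finset F) (k : ℕ) : Finset F :=
  (Fintype.piFinset (fun _ : Fin k => A)).image (fun f => ∑ i, f i)

lemma DD_add {A : Finset F} {k : ℕ} {x a : F} (hx : x ∈ DD A k) (ha : a ∈ A) :
    x + a ∈ DD A (k + 1) := by
  simp only [DD, mem_image, Fintype.mem_piFinset] at hx ⊢
  obtain ⟨f, hf, rfl⟩ := hx
  refine ⟨Fin.snoc f a, fun i => ?_, ?_⟩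
  · refine Fin.lastCases ?_ (fun j => ?_) i
    · simpa using ha
    · simpa using hf j
  · rw [Fin.sum_univ_castSucc]; simp

lemma zero_mem_DD (A : Finset F) : (0 : F) ∈ DD A 0 := by
  simp [DD]

lemma subset_DD_one (A : Finset F) : A ⊆ DD A 1 := by
  intro a ha
  have := DD_add (zero_mem_DD A) ha
  simpa using this

lemma DD_mono {A : Finset F} (h0 : (0 : F) ∈ A) : Monotone (DD A) := by
  refine monotone_nat_of_le_succ fun k x hx => ?_
  simpa using DD_add hx h0

lemma DD_card_succ_le (A : Finset F) (k : ℕ) (hA : A.Nonempty) :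
    (DD A k).card ≤ (DD A (k+1)).card := by
  obtain ⟨a, ha⟩ := hA
  refine card_le_card_of_injOn (fun x => x + a) (fun x hx => DD_add hx ha) ?_
  intro x _ y _ h
  simpa using h

lemma card_le_DD (A : Finset F) (k : ℕ) (hA : A.Nonempty) (hk : 1 ≤ k) :
    A.card ≤ (DD A k).card := by
  induction k, hk using Nat.le_induction with
  | base => exact card_le_card (subset_DD_one A)
  | succ n hn ih => exact ih.trans (DD_card_succ_le A n hA)

lemma DD_subset {A B : Finset F} (h : A ⊆ B) (k : ℕ) : DD A k ⊆ DD B k :=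
  image_subset_image (Fintype.piFinset_subset _ _ (fun _ => h))

lemma cross (v : F → ℝ) (hv : ∑ x, v x = 0) {b c : F} (hb : b ≠ 0) (hc : c ≠ 0) (hbc : b ≠ c) :
    ∑ x, ∑ p, v (x - p / b) * v (x - p / c) = 0 := by
  have hne : b⁻¹ - c⁻¹ ≠ 0 := by
    rw [sub_ne_zero]; exact fun h => hbc (inv_injective h)
  rw [sum_comm]
  have h1 : ∀ p : F, ∑ x, v (x - p / b) * v (x - p / c)
      = ∑ x, v x * v (x + p * (b⁻¹ - c⁻¹)) := by
    intro p
    rw [← Equiv.sum_comp (Equiv.addRight (p / b))]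
    refine sum_congr rfl fun x _ => ?_
    simp only [Equiv.coe_addRight, add_sub_cancel_right]
    congr 2; ring
  simp only [h1]
  rw [sum_comm]
  refine sum_eq_zero fun x _ => ?_
  rw [← mul_sum]
  have : ∑ p, v (x + p * (b⁻¹ - c⁻¹)) = ∑ y, v y := by
    exact Equiv.sum_comp ((Equiv.mulRight₀ _ hne).trans (Equiv.addLeft x)) v
  rw [this, hv, mul_zero]

lemma diag_sum (v : F → ℝ) (b : F) :
    ∑ x, ∑ p, v (x - p / b) * v (x - p / b) = (Fintype.card F : ℝ) * ∑ x, v x ^ 2 := by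
  rw [sum_comm]
  have h1 : ∀ p : F, ∑ x, v (x - p / b) * v (x - p / b) = ∑ x, v x ^ 2 := by
    intro p
    rw [← Equiv.sum_comp (Equiv.addRight (p / b))]
    refine sum_congr rfl fun x _ => ?_
    simp only [Equiv.coe_addRight, add_sub_cancel_right]
    ring
  simp [h1]

lemma op_bound (A P : Finset F) (h0 : (0 : F) ∉ A) (v : F → ℝ) (hv : ∑ x, v x = 0) :
    ∑ x, (∑ p ∈ P, ∑ b ∈ A, v (x - p / b)) ^ 2
      ≤ ((Fintype.card F : ℝ) * P.card * A.card) * ∑ x, v x ^ 2 := by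
  have h1 : ∀ x, (∑ p ∈ P, ∑ b ∈ A, v (x - p / b)) ^ 2
      ≤ (P.card : ℝ) * ∑ p, (∑ b ∈ A, v (x - p / b)) ^ 2 := by
    intro x
    refine sq_sum_le_card_mul_sum_sq.trans ?_
    gcongr
    exact subset_univ P
  refine (sum_le_sum fun x _ => h1 x).trans ?_
  rw [← mul_sum]
  have h2 : ∑ x, ∑ p, (∑ b ∈ A, v (x - p / b)) ^ 2
      = ∑ b ∈ A, ∑ c ∈ A, ∑ x, ∑ p, v (x - p / b) * v (x - p / c) := by
    simp only [sq, sum_mul_sum]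
    calc _ = ∑ x, ∑ b ∈ A, ∑ p, ∑ c ∈ A, v (x - p / b) * v (x - p / c) :=
          sum_congr rfl fun x _ => sum_comm
      _ = ∑ b ∈ A, ∑ x, ∑ p, ∑ c ∈ A, v (x - p / b) * v (x - p / c) := sum_comm
      _ = ∑ b ∈ A, ∑ x, ∑ c ∈ A, ∑ p, v (x - p / b) * v (x - p / c) :=
          sum_congr rfl fun b _ => sum_congr rfl fun x _ => sum_comm
      _ = _ := sum_congr rfl fun b _ => sum_comm
  have h3 : ∀ b ∈ A, ∑ c ∈ A, ∑ x, ∑ p, v (x - p / b) * v (x - p / c)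
      = (Fintype.card F : ℝ) * ∑ x, v x ^ 2 := by
    intro b hb
    rw [sum_eq_single_of_mem b hb, diag_sum]
    intro c hc hcb
    exact cross v hv (fun h => h0 (h ▸ hb)) (fun h => h0 (h ▸ hc)) hcb.symm
  rw [h2, sum_congr rfl h3, sum_const, nsmul_eq_mul]
  apply le_of_eq; ring

lemma exists_w (A P : Finset F) (h0 : (0 : F) ∉ A) (hP : ∀ a ∈ A, ∀ b ∈ A, a * b ∈ P) (k : ℕ) :
    ∃ w : F → ℝ, (∀ x, 0 ≤ w x) ∧
      (A.card : ℝ) * ((A.card : ℝ) ^ 2) ^ k ≤ ∑ x ∈ DD A (k + 1), w x ∧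
      ∑ x, w x = A.card * ((P.card : ℝ) * A.card) ^ k ∧
      ∑ x, (w x - (∑ y, w y) / Fintype.card F) ^ 2
        ≤ A.card * ((Fintype.card F : ℝ) * P.card * A.card) ^ k := by
  have hq : (0 : ℝ) < Fintype.card F := by exact_mod_cast Fintype.card_pos
  induction k with
  | zero =>
    refine ⟨fun x => if x ∈ A then 1 else 0, fun x => by positivity, ?_, ?_, ?_⟩
    · have : A ⊆ DD A (0 + 1) := subset_DD_one A
      rw [sum_ite_mem, inter_eq_right.mpr this]; simp
    · simp
    · simp only [pow_zero, mul_one]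
      set t : ℝ := (∑ y, if y ∈ A then (1:ℝ) else 0) / Fintype.card F with ht
      have hs : (∑ y, if y ∈ A then (1:ℝ) else 0) = A.card := by simp
      have h1 : ∀ x : F, ((if x ∈ A then (1:ℝ) else 0) - t) ^ 2
          = (1 - 2 * t) * (if x ∈ A then (1:ℝ) else 0) + t ^ 2 := by
        intro x; split_ifs <;> ring
      simp only [h1]
      rw [sum_add_distrib, ← mul_sum, hs, sum_const, card_univ, nsmul_eq_mul]
      have : t * Fintype.card F = A.card := by rw [ht, hs]; field_simp
      have ht0 : 0 ≤ t := by rw [ht, hs]; positivity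
      have : (1 - 2 * t) * A.card + Fintype.card F * t ^ 2 = A.card - t * A.card := by
        linear_combination t * this
      have : 0 ≤ t * (A.card : ℝ) := by positivity
      linarith
  | succ k ih =>
    obtain ⟨w, hw0, hlow, hsum, hvar⟩ := ih
    have hsum' : ∑ x, ∑ p ∈ P, ∑ b ∈ A, w (x - p / b) = (P.card * A.card : ℝ) * ∑ x, w x := by
      have h1 : ∀ y : F, ∑ x, w (x - y) = ∑ x, w x := fun y =>
        Equiv.sum_comp (Equiv.subRight y) w
      rw [sum_comm]
      calc _ = ∑ p ∈ P, ∑ b ∈ A, ∑ x, w (x - p / b) := sum_congr rfl fun p _ => sum_comm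
        _ = _ := by simp only [h1, sum_const, nsmul_eq_mul]; ring
    refine ⟨fun x => ∑ p ∈ P, ∑ b ∈ A, w (x - p / b),
      fun x => sum_nonneg fun p _ => sum_nonneg fun b _ => hw0 _, ?_, ?_, ?_⟩
    · have h1 : ∀ x, ∑ b ∈ A, ∑ a ∈ A, w (x - a) ≤ ∑ p ∈ P, ∑ b ∈ A, w (x - p / b) := by
        intro x
        rw [sum_comm (s := P)]
        refine sum_le_sum fun b hb => ?_
        have hb0 : b ≠ 0 := fun h => h0 (h ▸ hb)
        have : ∑ a ∈ A, w (x - a) = ∑ p ∈ A.image (fun a => a * b), w (x - p / b) := by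
          rw [sum_image (fun a _ c _ h => mul_right_cancel₀ hb0 h)]
          refine sum_congr rfl fun a _ => ?_
          rw [mul_div_cancel_right₀ _ hb0]
        rw [this]
        refine sum_le_sum_of_subset_of_nonneg ?_ fun _ _ _ => hw0 _
        intro p hp
        obtain ⟨a, ha, rfl⟩ := mem_image.mp hp
        exact hP a ha b hb
      have h2 : ∀ a ∈ A, ∑ y ∈ DD A (k + 1), w y ≤ ∑ x ∈ DD A (k + 1 + 1), w (x - a) := by
        intro a ha
        have : ∑ y ∈ DD A (k + 1), w y = ∑ x ∈ (DD A (k+1)).image (fun y => y + a), w (x - a) := by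
          rw [sum_image (fun x _ y _ h => add_right_cancel h)]
          simp
        rw [this]
        refine sum_le_sum_of_subset_of_nonneg ?_ fun _ _ _ => hw0 _
        intro p hp
        obtain ⟨y, hy, rfl⟩ := mem_image.mp hp
        exact DD_add hy ha
      calc (A.card : ℝ) * ((A.card : ℝ) ^ 2) ^ (k + 1)
          = (A.card : ℝ) ^ 2 * ((A.card : ℝ) * ((A.card : ℝ) ^ 2) ^ k) := by ring
        _ ≤ (A.card : ℝ) ^ 2 * ∑ y ∈ DD A (k + 1), w y := by gcongr
        _ = ∑ b ∈ A, ∑ a ∈ A, ∑ y ∈ DD A (k + 1), w y := by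
            simp only [sum_const, nsmul_eq_mul]; ring
        _ ≤ ∑ b ∈ A, ∑ a ∈ A, ∑ x ∈ DD A (k + 1 + 1), w (x - a) :=
            sum_le_sum fun b _ => sum_le_sum fun a ha => h2 a ha
        _ = ∑ x ∈ DD A (k + 1 + 1), ∑ b ∈ A, ∑ a ∈ A, w (x - a) := by
            rw [sum_comm (s := DD A (k + 1 + 1))]
            exact sum_congr rfl fun b _ => sum_comm
        _ ≤ _ := sum_le_sum fun x _ => h1 x
    · rw [hsum', hsum]; ring
    · set μ : ℝ := (∑ y, w y) / Fintype.card F with hμ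
      have hv : ∑ x, (w x - μ) = 0 := by
        rw [sum_sub_distrib, sum_const, card_univ, nsmul_eq_mul, hμ]; field_simp; ring
      have h1 : ∀ x, (∑ p ∈ P, ∑ b ∈ A, w (x - p / b))
            - (∑ y, ∑ p ∈ P, ∑ b ∈ A, w (y - p / b)) / Fintype.card F
          = ∑ p ∈ P, ∑ b ∈ A, (w (x - p / b) - μ) := by
        intro x
        rw [hsum']
        simp only [sum_sub_distrib, sum_const, nsmul_eq_mul]
        rw [hμ]; ring
      simp only [h1]
      refine (op_bound A P h0 (fun x => w x - μ) hv).trans ?_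
      rw [pow_succ]
      calc _ ≤ ((Fintype.card F : ℝ) * P.card * A.card) *
            (A.card * ((Fintype.card F : ℝ) * P.card * A.card) ^ k) := by gcongr
        _ = _ := by ring

/-- The main estimate, away from zero. -/
lemma energy_main (A P : Finset F) (h0 : (0 : F) ∉ A) (hP : ∀ a ∈ A, ∀ b ∈ A, a * b ∈ P)
    (hA : A.Nonempty) (k : ℕ) :
    (1 / 4 : ℝ) * min ((Fintype.card F : ℝ) * (A.card : ℝ) ^ k)
        ((A.card : ℝ) ^ (3 * k + 1) / (Fintype.card F : ℝ) ^ k)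
      ≤ (P.card : ℝ) ^ k * (DD A (k + 1)).card := by
  obtain ⟨w, hw0, hlow, hsum, hvar⟩ := exists_w A P h0 hP k
  have hq : (0 : ℝ) < Fintype.card F := by exact_mod_cast Fintype.card_pos
  have hn : (0 : ℝ) < A.card := by exact_mod_cast hA.card_pos
  set q : ℝ := (Fintype.card F : ℝ)
  set n : ℝ := (A.card : ℝ)
  set m : ℝ := (P.card : ℝ)
  set D := DD A (k + 1)
  set μ := (∑ y, w y) / q with hμ
  have hm : 0 ≤ m := by positivity
  have h1 : ∑ x ∈ D, w x = D.card * μ + ∑ x ∈ D, (w x - μ) := by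
    rw [sum_sub_distrib, sum_const, nsmul_eq_mul]; ring
  have h2 : (∑ x ∈ D, (w x - μ)) ^ 2 ≤ D.card * (n * (q * m * n) ^ k) := by
    refine sq_sum_le_card_mul_sum_sq.trans ?_
    gcongr
    refine le_trans ?_ hvar
    exact sum_le_sum_of_subset_of_nonneg (subset_univ _) fun _ _ _ => sq_nonneg _
  set E := ∑ x ∈ D, (w x - μ)
  by_cases hc : n * (n ^ 2) ^ k / 2 ≤ D.card * μ
  · have : (1 / 2 : ℝ) * (q * n ^ k) ≤ m ^ k * D.card := by
      have e1 : D.card * μ = (m ^ k * D.card) * (n * n ^ k / q) := by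
        rw [hμ, hsum, mul_pow]; ring
      have e2 : n * (n ^ 2) ^ k / 2 = ((1 / 2 : ℝ) * (q * n ^ k)) * (n * n ^ k / q) := by
        rw [← pow_mul, mul_comm 2 k, pow_mul]; field_simp
      rw [e1, e2] at hc
      exact le_of_mul_le_mul_right hc (by positivity)
    have h3 := min_le_left (q * n ^ k) (n ^ (3 * k + 1) / q ^ k)
    have : 0 ≤ q * n ^ k := by positivity
    linarith
  · push Not at hc
    have hE : n * (n ^ 2) ^ k / 2 ≤ E := by linarith
    have hE2 : (n * (n ^ 2) ^ k / 2) ^ 2 ≤ D.card * (n * (q * m * n) ^ k) :=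
      le_trans (pow_le_pow_left₀ (by positivity) hE 2) h2
    have : (1 / 4 : ℝ) * (n ^ (3 * k + 1) / q ^ k) ≤ m ^ k * D.card := by
      have e1 : D.card * (n * (q * m * n) ^ k) = (m ^ k * D.card) * (n * n ^ k * q ^ k) := by
        rw [mul_pow, mul_pow]; ring
      have e2 : (n * (n ^ 2) ^ k / 2) ^ 2
          = ((1 / 4 : ℝ) * (n ^ (3 * k + 1) / q ^ k)) * (n * n ^ k * q ^ k) := by
        field_simp; ring
      rw [e1, e2] at hE2
      exact le_of_mul_le_mul_right hE2 (by positivity)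
    have h3 := min_le_right (q * n ^ k) (n ^ (3 * k + 1) / q ^ k)
    linarith

end energy
section growth
set_option linter.unusedSectionVars false
variable {F : Type} [Field F] [Fintype F] [DecidableEq F]

lemma subring_top (R : Subring F) (hR : Fintype.card F < (Nat.card R) ^ 2) : R = ⊤ := by
  have hinv : ∀ s ∈ R, s⁻¹ ∈ R := by
    intro s hs
    by_cases h : s = 0
    · simp [h, R.zero_mem]
    · have h1 : s ^ (Fintype.card F - 1) = 1 := FiniteField.pow_card_sub_one_eq_one s h
      have h2 : s ^ (Fintype.card F - 2) * s = 1 := by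
        rw [← pow_succ, ← h1]; congr 1
        have := Fintype.one_lt_card (α := F); omega
      rw [← eq_inv_of_mul_eq_one_left h2]
      exact R.pow_mem hs _
  by_contra hne
  obtain ⟨x, hx⟩ : ∃ x, x ∉ R := by
    by_contra! h
    exact hne (eq_top_iff.mpr fun x _ => h x)
  have hinj : Function.Injective (fun p : R × R => (p.1 : F) + p.2 * x) := by
    rintro ⟨r, s⟩ ⟨r', s'⟩ h
    simp only at h
    have hs : s = s' := by
      by_contra hss
      have h3 : (s : F) - s' ≠ 0 := by
        rw [sub_ne_zero]; exact fun h => hss (Subtype.ext h)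
      apply hx
      have : x = ((r' : F) - r) * ((s : F) - s')⁻¹ := by
        field_simp; linear_combination h
      rw [this]
      exact R.mul_mem (R.sub_mem r'.2 r.2) (hinv _ (R.sub_mem s.2 s'.2))
    subst hs
    have : r = r' := Subtype.ext (by simpa using h)
    rw [this]
  have := Nat.card_le_card_of_injective _ hinj
  rw [Nat.card_prod, Nat.card_eq_fintype_card (α := F)] at this
  nlinarith

lemma stab_top (H U : Finset F) (x : F) (hx : x ≠ 0) (h1 : (1 : F) ∈ H) (hH0 : (0 : F) ∉ H)
    (hmul : ∀ a ∈ H, ∀ b ∈ H, a * b ∈ H) (hbig : Fintype.card F < (H.card + 1) ^ 2)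
    (hU0 : (0 : F) ∈ U) (hU : ∀ u ∈ U, ∀ h ∈ H, u + x * h ∈ U) : U = univ := by
  have hR : Subring.closure (H : Set F) = ⊤ := by
    apply subring_top
    refine hbig.trans_le ?_
    gcongr
    have hs : ((insert 0 H : Finset F) : Set F) ⊆ (Subring.closure (H : Set F) : Set F) := by
      intro y hy
      rcases mem_insert.mp (mem_coe.mp hy) with rfl | hy
      · exact Subring.zero_mem _
      · exact Subring.subset_closure hy
    have := Nat.card_mono (Set.toFinite _) hs
    rw [← card_insert_of_notMem hH0]
    simpa using this
  let M : Submonoid F :=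
    { carrier := H, one_mem' := h1, mul_mem' := fun {a b} ha hb => hmul a ha b hb }
  have hM : Submonoid.closure (H : Set F) = M := Submonoid.closure_eq M
  have hstep : ∀ (k : ℕ) (y : F), (∀ u ∈ U, u + x * y ∈ U) → ∀ u ∈ U, u + x * (k • y) ∈ U := by
    intro k y hy
    induction k with
    | zero => simp
    | succ k ih =>
      intro u hu
      have := hy _ (ih u hu)
      convert this using 1
      simp only [nsmul_eq_mul]; push_cast; ring
  let T : AddSubgroup F :=
    { carrier := {y | ∀ u ∈ U, u + x * y ∈ U}
      zero_mem' := by simp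
      add_mem' := by
        intro a b ha hb u hu
        have := hb _ (ha u hu)
        convert this using 1; ring
      neg_mem' := by
        intro y hy u hu
        have := hstep (Fintype.card F - 1) y hy u hu
        have hc : ((Fintype.card F - 1 : ℕ) : F) = -1 := by
          rw [Nat.cast_sub Fintype.card_pos]; simp
        rw [nsmul_eq_mul, hc] at this
        simpa using this }
  have hT : AddSubgroup.closure (H : Set F) ≤ T := by
    rw [AddSubgroup.closure_le]
    intro h hh u hu
    exact hU u hu h hh
  refine eq_univ_iff_forall.mpr fun z => ?_
  have hz : x⁻¹ * z ∈ Subring.closure (H : Set F) := by rw [hR]; trivial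
  rw [Subring.mem_closure_iff, hM] at hz
  have := hT hz 0 hU0
  rwa [zero_add, mul_inv_cancel_left₀ hx] at this

lemma growth (A H : Finset F) (x : F) (hx : x ≠ 0) (h0A : (0 : F) ∈ A) (h1 : (1 : F) ∈ H)
    (hH0 : (0 : F) ∉ H)
    (hmul : ∀ a ∈ H, ∀ b ∈ H, a * b ∈ H) (hinv : ∀ a ∈ H, a⁻¹ ∈ H)
    (hbig : Fintype.card F < (H.card + 1) ^ 2)
    (hsub : ∀ a ∈ A, a ≠ 0 → x⁻¹ * a ∈ H) (j : ℕ) (hj : H.card ≤ (A.erase 0).card + j) (t : ℕ) :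
    ∃ U : Finset F, (0 : F) ∈ U ∧ (∀ h ∈ H, ∀ u ∈ U, h * u ∈ U) ∧
      (U = univ ∨ 1 + t * H.card ≤ U.card) ∧
      ∀ u ∈ U, H.card ≤ (H.filter (fun l => l * u ∈ DD A t)).card + t * j := by
  induction t with
  | zero =>
    refine ⟨{0}, by simp, by simp, by simp, ?_⟩
    simp [zero_mem_DD]
  | succ t ih =>
    obtain ⟨U, hU0, hUH, hUc, hUd⟩ := ih
    have hmono := DD_mono h0A (Nat.le_succ t)
    have hold : ∀ u ∈ U, H.card ≤ (H.filter (fun l => l * u ∈ DD A (t + 1))).card + (t + 1) * j := by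
      intro u hu
      refine (hUd u hu).trans ?_
      have : (H.filter (fun l => l * u ∈ DD A t)).card
          ≤ (H.filter (fun l => l * u ∈ DD A (t + 1))).card := by
        apply card_le_card
        intro l hl
        rw [mem_filter] at hl ⊢
        exact ⟨hl.1, hmono hl.2⟩
      nlinarith
    by_cases hstab : ∀ u ∈ U, ∀ h ∈ H, u + x * h ∈ U
    · exact ⟨U, hU0, hUH, Or.inl (stab_top H U x hx h1 hH0 hmul hbig hU0 hstab), hold⟩
    push Not at hstab
    obtain ⟨u, hu, h, hh, hnot⟩ := hstab
    have hhne : h ≠ 0 := fun e => hH0 (e ▸ hh)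
    set z := u + x * h with hz
    have hz0 : z ≠ 0 := fun e => hnot (e ▸ hU0)
    have hUcard : 1 + t * H.card ≤ U.card := by
      rcases hUc with rfl | h
      · exact absurd (mem_univ _) hnot
      · exact h
    -- count for z
    have hcz : H.card ≤ (H.filter (fun l => l * z ∈ DD A (t + 1))).card + (t + 1) * j := by
      have ha : (A.erase 0).card ≤ (H.filter (fun l => l * (x * h) ∈ A)).card := by
        refine card_le_card_of_injOn (fun a => a * (x * h)⁻¹) ?_ ?_
        · intro a ha
          have ha := mem_erase.mp (mem_coe.mp ha)
          rw [mem_coe, mem_filter]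
          refine ⟨?_, ?_⟩
          · have := hmul _ (hsub a ha.2 ha.1) _ (hinv h hh)
            convert this using 1
            rw [mul_inv]; ring
          · simp only
            rw [inv_mul_cancel_right₀ (mul_ne_zero hx hhne)]
            exact ha.2
        · intro a _ b _ hab
          exact mul_right_cancel₀ (inv_ne_zero (mul_ne_zero hx hhne)) hab
      have hd := hUd u hu
      have hsub2 : (H.filter (fun l => l * u ∈ DD A t)) ∩ (H.filter (fun l => l * (x * h) ∈ A))
          ⊆ H.filter (fun l => l * z ∈ DD A (t + 1)) := by
        intro l hl
        simp only [mem_inter, mem_filter] at hl ⊢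
        refine ⟨hl.1.1, ?_⟩
        rw [hz, mul_add]
        exact DD_add hl.1.2 hl.2.2
      have h3 := card_le_card hsub2
      have h4 := card_union_add_card_inter (H.filter (fun l => l * u ∈ DD A t))
        (H.filter (fun l => l * (x * h) ∈ A))
      have h5 : ((H.filter (fun l => l * u ∈ DD A t)) ∪
        (H.filter (fun l => l * (x * h) ∈ A))).card ≤ H.card :=
        card_le_card (union_subset (filter_subset _ _) (filter_subset _ _))
      have : (t + 1) * j = t * j + j := by ring
      omega
    refine ⟨U ∪ H.image (fun l => l * z), mem_union_left _ hU0, ?_, Or.inr ?_, ?_⟩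
    · intro l hl y hy
      rcases mem_union.mp hy with hy | hy
      · exact mem_union_left _ (hUH l hl y hy)
      · obtain ⟨l', hl', rfl⟩ := mem_image.mp hy
        refine mem_union_right _ (mem_image.mpr ⟨l * l', hmul l hl l' hl', by ring⟩)
    · rw [card_union_of_disjoint, card_image_of_injective _ (mul_left_injective₀ hz0)]
      · nlinarith
      · rw [disjoint_left]
        intro y hy hy2
        obtain ⟨l, hl, rfl⟩ := mem_image.mp hy2
        have hl0 : l ≠ 0 := fun e => hH0 (e ▸ hl)
        have := hUH _ (hinv l hl) _ hy
        rw [inv_mul_cancel_left₀ hl0] at this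
        exact hnot this
    · intro y hy
      rcases mem_union.mp hy with hy | hy
      · exact hold y hy
      · obtain ⟨l', hl', rfl⟩ := mem_image.mp hy
        have hl0 : l' ≠ 0 := fun e => hH0 (e ▸ hl')
        refine hcz.trans ?_
        gcongr ?_ + _
        refine card_le_card_of_injOn (fun l => l * l'⁻¹) ?_ ?_
        · intro l hl
          have hl := mem_filter.mp (mem_coe.mp hl)
          rw [mem_coe, mem_filter]
          refine ⟨hmul _ hl.1 _ (hinv _ hl'), ?_⟩
          convert hl.2 using 1
          field_simp
        · intro a _ b _ hab
          exact mul_right_cancel₀ (inv_ne_zero hl0) hab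

/-- `|tA| |H| ≥ |U| (|H| - t j)`. -/
lemma growth_card (A H : Finset F) (x : F) (hx : x ≠ 0) (h0A : (0 : F) ∈ A) (h1 : (1 : F) ∈ H)
    (hH0 : (0 : F) ∉ H)
    (hmul : ∀ a ∈ H, ∀ b ∈ H, a * b ∈ H) (hinv : ∀ a ∈ H, a⁻¹ ∈ H)
    (hbig : Fintype.card F < (H.card + 1) ^ 2)
    (hsub : ∀ a ∈ A, a ≠ 0 → x⁻¹ * a ∈ H) (j : ℕ) (hj : H.card ≤ (A.erase 0).card + j) (t : ℕ)
    (ht : 2 * (t * j) ≤ H.card) :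
    min (Fintype.card F) (t * H.card) ≤ 2 * (DD A t).card := by
  obtain ⟨U, hU0, hUH, hUc, hUd⟩ := growth A H x hx h0A h1 hH0 hmul hinv hbig hsub j hj t
  have hHpos : 0 < H.card := card_pos.mpr ⟨1, h1⟩
  have h2 : ∀ u ∈ U, H.card ≤ 2 * (H.filter (fun l => l * u ∈ DD A t)).card := by
    intro u hu
    have := hUd u hu
    omega
  have h3 : U.card * H.card ≤ 2 * ∑ u ∈ U, (H.filter (fun l => l * u ∈ DD A t)).card := by
    rw [mul_sum, ← smul_eq_mul, ← sum_const]
    exact sum_le_sum h2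
  have h4 : ∑ u ∈ U, (H.filter (fun l => l * u ∈ DD A t)).card
      = ∑ l ∈ H, (U.filter (fun u => l * u ∈ DD A t)).card := by
    simp only [card_filter]
    exact sum_comm
  have h5 : ∀ l ∈ H, (U.filter (fun u => l * u ∈ DD A t)).card ≤ (DD A t).card := by
    intro l hl
    have hl0 : l ≠ 0 := fun e => hH0 (e ▸ hl)
    refine card_le_card_of_injOn (fun u => l * u) ?_ ?_
    · intro u hu
      exact (mem_filter.mp (mem_coe.mp hu)).2
    · intro a _ b _ hab
      exact mul_left_cancel₀ hl0 hab
  have h6 : ∑ l ∈ H, (U.filter (fun u => l * u ∈ DD A t)).card ≤ H.card * (DD A t).card := by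
    rw [← smul_eq_mul, ← sum_const]
    exact sum_le_sum h5
  have h7 : U.card ≤ 2 * (DD A t).card := by
    have : U.card * H.card ≤ (2 * (DD A t).card) * H.card := by
      rw [h4] at h3; nlinarith
    exact le_of_mul_le_mul_right this hHpos
  rcases hUc with rfl | h
  · rw [card_univ] at h7
    exact (min_le_left _ _).trans h7
  · exact (min_le_right _ _).trans (by omega)

open scoped Pointwise in
lemma structure_lemma (A P : Finset F) (h0 : (0 : F) ∉ A) 
    (hP : P = (A ×ˢ A).image (fun p => p.1 * p.2)) (hlt : 2 * P.card < 3 * A.card) :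
    ∃ (H : Finset F) (x : F), x ≠ 0 ∧ (1 : F) ∈ H ∧ (0 : F) ∉ H ∧
      (∀ a ∈ H, ∀ b ∈ H, a * b ∈ H) ∧ (∀ a ∈ H, a⁻¹ ∈ H) ∧ (∀ a ∈ A, x⁻¹ * a ∈ H) ∧
      H.card = P.card := by
  classical
  let B : Finset Fˣ := univ.filter (fun u => (u : F) ∈ A)
  have hinj : Function.Injective (fun u : Fˣ => (u : F)) := Units.val_injective
  have hBA : B.image (fun u : Fˣ => (u : F)) = A := by
    ext a
    simp only [B, mem_image, mem_filter, mem_univ, true_and]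
    constructor
    · rintro ⟨u, hu, rfl⟩; exact hu
    · intro ha
      exact ⟨Units.mk0 a (fun e => h0 (e ▸ ha)), ha, rfl⟩
  have hBP : (B * B).image (fun u : Fˣ => (u : F)) = P := by
    rw [hP, ← hBA]
    ext y
    simp only [mem_image, mem_mul, mem_product, Prod.exists]
    constructor
    · rintro ⟨_, ⟨a, ha, b, hb, rfl⟩, rfl⟩
      exact ⟨a, b, ⟨⟨a, ha, rfl⟩, b, hb, rfl⟩, by simp⟩
    · rintro ⟨_, _, ⟨⟨a, ha, rfl⟩, b, hb, rfl⟩, rfl⟩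
      exact ⟨a * b, ⟨a, ha, b, hb, rfl⟩, by simp⟩
  have hcB : B.card = A.card := by rw [← hBA, card_image_of_injective _ hinj]
  have hcP : (B * B).card = P.card := by rw [← hBP, card_image_of_injective _ hinj]
  have hd : ((B * B).card : ℚ) < (3 / 2 : ℚ) * B.card := by
    rw [hcB, hcP]
    have : (2 * P.card : ℚ) < 3 * A.card := by exact_mod_cast hlt
    linarith
  have hmemG : ∀ u : Fˣ, u ∈ Finset.invMulSubgroup B hd ↔ u ∈ B⁻¹ * B := by
    intro u
    rw [← SetLike.mem_coe, Finset.invMulSubgroup_eq_inv_mul, ← mem_coe]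
    push_cast
    rfl
  have hBne : B.Nonempty := by
    rw [← card_pos, hcB]; omega
  obtain ⟨b, hb⟩ := hBne
  refine ⟨(B⁻¹ * B).image (fun u : Fˣ => (u : F)), b, b.ne_zero, ?_, ?_, ?_, ?_, ?_, ?_⟩
  · exact mem_image.mpr ⟨1, (hmemG 1).mp (Subgroup.one_mem _), rfl⟩
  · intro h
    obtain ⟨u, _, hu⟩ := mem_image.mp h
    exact u.ne_zero hu
  · intro a ha c hc
    obtain ⟨u, hu, rfl⟩ := mem_image.mp ha
    obtain ⟨v, hv, rfl⟩ := mem_image.mp hc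
    exact mem_image.mpr ⟨u * v, (hmemG _).mp
      (Subgroup.mul_mem _ ((hmemG _).mpr hu) ((hmemG _).mpr hv)), by simp⟩
  · intro a ha
    obtain ⟨u, hu, rfl⟩ := mem_image.mp ha
    exact mem_image.mpr ⟨u⁻¹, (hmemG _).mp
      (Subgroup.inv_mem _ ((hmemG _).mpr hu)), by simp⟩
  · intro a ha
    rw [← hBA] at ha
    obtain ⟨u, hu, rfl⟩ := mem_image.mp ha
    exact mem_image.mpr ⟨b⁻¹ * u, mul_mem_mul (inv_mem_inv hb) hu, by simp⟩
  · rw [card_image_of_injective _ hinj, ← hcP]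
    exact Finset.card_inv_mul_of_doubling_lt_three_halves hd

end growth

section final
set_option linter.unusedSectionVars false
variable {F : Type} [Field F] [Fintype F] [DecidableEq F]

lemma bern (N j k : ℕ) (hN : 1 ≤ N) (hk : N ≤ k) :
    (N : ℝ) ^ k * (1 + j) ≤ ((N : ℝ) + j) ^ k := by
  have hN' : (0 : ℝ) < N := by exact_mod_cast hN
  have e : (N : ℝ) + j = N * (1 + j / N) := by field_simp
  rw [e, mul_pow]
  gcongr
  have h1 := one_add_mul_le_pow (a := (j : ℝ) / N) (by
    have : (0 : ℝ) ≤ j / N := by positivity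
    linarith) k
  refine le_trans ?_ h1
  have : (j : ℝ) ≤ k * (j / N) := by
    rw [mul_div_assoc', le_div_iff₀ hN']
    have : (N : ℝ) ≤ k := by exact_mod_cast hk
    have hj : (0 : ℝ) ≤ j := by positivity
    nlinarith
  linarith

/-- The case of many summands: `S (1 + j) ≥ q / 32`. -/
lemma big_d (A P : Finset F) (h0 : (0 : F) ∈ A)
    (hP : P = ((A.erase 0) ×ˢ (A.erase 0)).image (fun p => p.1 * p.2))
    (hbig : Fintype.card F < A.card ^ 2) (d j : ℕ) (hd : A.card ≤ d)
    (hj : P.card = (A.erase 0).card + j) :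
    Fintype.card F ≤ 32 * ((1 + j) * (DD A d).card) := by
  have hn : (A.erase 0).card + 1 = A.card := card_erase_add_one h0
  have hq := Fintype.one_lt_card (α := F)
  have hN2 : 2 ≤ A.card := by nlinarith
  have hS : A.card ≤ (DD A d).card := card_le_DD A d ⟨0, h0⟩ (by omega)
  by_cases hlt : 2 * P.card < 3 * (A.erase 0).card
  · obtain ⟨H, x, hx, h1, hH0, hmul, hinv, hsub, hc⟩ :=
      structure_lemma (A.erase 0) P (by simp) hP hlt
    set t := H.card / (2 * (1 + j)) with ht
    have ht1 : t * (2 * (1 + j)) ≤ H.card := Nat.div_mul_le_self _ _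
    have ht2 : H.card < (t + 1) * (2 * (1 + j)) := by
      have := Nat.lt_div_mul_add (a := H.card) (b := 2 * (1 + j)) (by omega)
      rw [← ht] at this; linarith
    rcases Nat.eq_zero_or_pos t with h | hpos
    · rw [h] at ht2
      have : A.card ≤ 4 * (1 + j) := by omega
      have := Nat.mul_le_mul this hS
      nlinarith
    · have hg := growth_card A H x hx h0 h1 hH0 hmul hinv
        (hbig.trans_le (Nat.pow_le_pow_left (by omega) 2))
        (fun a ha hne => hsub a (mem_erase.mpr ⟨hne, ha⟩)) j (by omega) t (by nlinarith)
      have htd : t ≤ d := by nlinarith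
      have hD : (DD A t).card ≤ (DD A d).card := card_le_card (DD_mono h0 htd)
      rcases min_le_iff.mp hg with hg | hg
      · nlinarith
      · have h5 : H.card ≤ 4 * (t * (1 + j)) := by nlinarith
        have h6 : A.card ≤ 2 * H.card := by omega
        have h7 : H.card * H.card ≤ 4 * (1 + j) * (t * H.card) := by nlinarith
        have h8 : 4 * (1 + j) * (t * H.card) ≤ 4 * (1 + j) * (2 * (DD A d).card) :=
          Nat.mul_le_mul_left _ (by omega)
        have h9 := Nat.mul_le_mul h6 h6
        have h10 : 4 * (1 + j) * (2 * (DD A d).card) = 8 * ((1 + j) * (DD A d).card) := by ring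
        have h11 : 2 * H.card * (2 * H.card) = 4 * (H.card * H.card) := by ring
        rw [sq] at hbig
        omega
  · have : A.card ≤ 2 * (1 + j) := by omega
    have := Nat.mul_le_mul this hS
    nlinarith

lemma small_loss (n k : ℕ) (hn : 1 ≤ n) (hk : k ≤ n) :
    Real.exp (-7) * ((n : ℝ) + 1) ^ (3 * k + 1) ≤ (n : ℝ) ^ (3 * k + 1) := by
  have hn' : (1 : ℝ) ≤ n := by exact_mod_cast hn
  have hk' : (k : ℝ) ≤ n := by exact_mod_cast hk
  have h1 : (n : ℝ) + 1 ≤ n * Real.exp (1 / n) := by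
    have := Real.add_one_le_exp (1 / (n : ℝ))
    calc (n : ℝ) + 1 = n * (1 / n + 1) := by field_simp; ring
      _ ≤ _ := by gcongr
  calc Real.exp (-7) * ((n : ℝ) + 1) ^ (3 * k + 1)
      ≤ Real.exp (-7) * (n * Real.exp (1 / n)) ^ (3 * k + 1) := by gcongr
    _ = (n : ℝ) ^ (3 * k + 1) * Real.exp (-7 + (3 * k + 1 : ℕ) * (1 / n)) := by
        rw [mul_pow, Real.exp_add, Real.exp_nat_mul]; ring
    _ ≤ (n : ℝ) ^ (3 * k + 1) * 1 := by
        gcongr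
        rw [Real.exp_le_one_iff]
        push_cast
        have : (3 * (k : ℝ) + 1) * (1 / n) ≤ 4 := by
          rw [mul_one_div, div_le_iff₀ (by linarith)]; linarith
        linarith
    _ = _ := mul_one _

lemma final_aux (A : Finset F) (k : ℕ) (hk : 1 ≤ k) :
    (Real.exp (-7) / 4) * min ((Fintype.card F : ℝ) * (A.card : ℝ) ^ k)
        ((A.card : ℝ) ^ (3 * k + 1) / (Fintype.card F : ℝ) ^ k)
      ≤ (((A ×ˢ A).image (fun p => p.1 * p.2)).card : ℝ) ^ k * ((DD A (k + 1)).card : ℝ) := by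
  set M := ((A ×ˢ A).image (fun p => p.1 * p.2)) with hM
  have hmemM : ∀ a ∈ A, ∀ b ∈ A, a * b ∈ M := fun a ha b hb =>
    mem_image.mpr ⟨(a, b), mem_product.mpr ⟨ha, hb⟩, rfl⟩
  have hq1 : (1 : ℝ) ≤ Fintype.card F := by exact_mod_cast Fintype.card_pos
  have hq : (0 : ℝ) < Fintype.card F := by linarith
  have hc0 : 0 < Real.exp (-7) := Real.exp_pos _
  have hc1 : Real.exp (-7) ≤ 1 / 8 := by
    have := Real.add_one_le_exp (7 : ℝ)
    rw [Real.exp_neg, ← one_div]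
    exact one_div_le_one_div_of_le (by norm_num) (by linarith)
  rcases A.eq_empty_or_nonempty with rfl | hne
  · simp only [card_empty, Nat.cast_zero]
    rw [zero_pow (by omega), zero_pow (by omega)]
    simp only [mul_zero, zero_div, min_self]
    positivity
  have hS := card_le_DD A (k + 1) hne (by omega)
  have hN1 : 1 ≤ A.card := hne.card_pos
  have hMN : A.card ≤ M.card := by
    by_cases h : ∃ a ∈ A, a ≠ 0
    · obtain ⟨a, ha, ha0⟩ := h
      refine card_le_card_of_injOn (fun b => a * b) (fun b hb => hmemM a ha b hb) ?_
      intro b _ c _ hbc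
      exact mul_left_cancel₀ ha0 hbc
    · push Not at h
      have h1 : A ⊆ {0} := fun a ha => by simp [h a ha]
      have h2 := card_le_card h1
      obtain ⟨a, ha⟩ := hne
      have h3 : 1 ≤ M.card := card_pos.mpr ⟨_, hmemM a ha a ha⟩
      simp at h2; omega
  by_cases hsmall : A.card ^ 2 ≤ Fintype.card F
  · have h1 : (A.card : ℝ) ^ (3 * k + 1) / (Fintype.card F : ℝ) ^ k ≤ (A.card : ℝ) ^ k * A.card := by
      rw [div_le_iff₀ (by positivity)]
      have : ((A.card : ℝ) ^ 2) ^ k ≤ (Fintype.card F : ℝ) ^ k := by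
        gcongr; exact_mod_cast hsmall
      calc (A.card : ℝ) ^ (3 * k + 1) = (A.card : ℝ) ^ k * A.card * ((A.card : ℝ) ^ 2) ^ k := by ring
        _ ≤ _ := by gcongr
    have h2 : (A.card : ℝ) ^ k * A.card ≤ (M.card : ℝ) ^ k * ((DD A (k + 1)).card : ℝ) := by
      gcongr
    have h3 := min_le_right ((Fintype.card F : ℝ) * (A.card : ℝ) ^ k)
        ((A.card : ℝ) ^ (3 * k + 1) / (Fintype.card F : ℝ) ^ k)
    have h4 : 0 ≤ min ((Fintype.card F : ℝ) * (A.card : ℝ) ^ k)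
        ((A.card : ℝ) ^ (3 * k + 1) / (Fintype.card F : ℝ) ^ k) := by positivity
    nlinarith
  push Not at hsmall
  by_cases h0 : (0 : F) ∈ A
  swap
  · refine le_trans ?_ (energy_main A M h0 hmemM hne k)
    gcongr
    linarith
  set A' := A.erase 0 with hA'
  have hn : A'.card + 1 = A.card := card_erase_add_one h0
  have hN2 : 2 ≤ A.card := by
    have := Fintype.one_lt_card (α := F)
    nlinarith
  set P := (A' ×ˢ A').image (fun p => p.1 * p.2) with hP
  have hPM : P.card + 1 ≤ M.card := by
    have h0P : (0 : F) ∉ P := by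
      intro h
      obtain ⟨⟨a, b⟩, hab, h⟩ := mem_image.mp h
      simp [hA'] at hab h
      tauto
    rw [← card_insert_of_notMem h0P]
    apply card_le_card
    intro y hy
    rcases mem_insert.mp hy with rfl | hy
    · simpa using hmemM 0 h0 0 h0
    · obtain ⟨⟨a, b⟩, hab, rfl⟩ := mem_image.mp hy
      have := mem_product.mp hab
      exact hmemM a (mem_of_mem_erase this.1) b (mem_of_mem_erase this.2)
  have hne' : A'.Nonempty := card_pos.mp (by omega)
  have hmemP : ∀ a ∈ A', ∀ b ∈ A', a * b ∈ P := fun a ha b hb =>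
    mem_image.mpr ⟨(a, b), mem_product.mpr ⟨ha, hb⟩, rfl⟩
  have hcast : (A.card : ℝ) = A'.card + 1 := by exact_mod_cast hn.symm
  by_cases hkn : k ≤ A'.card
  · have hE := energy_main A' P (by simp [hA']) hmemP hne' k
    have hloss := small_loss A'.card k (by omega) hkn
    rw [← hcast] at hloss
    have hloss2 : Real.exp (-7) * (A.card : ℝ) ^ k ≤ (A'.card : ℝ) ^ k := by
      have hpos : (0 : ℝ) < (A.card : ℝ) ^ (2 * k + 1) := by positivity
      refine le_of_mul_le_mul_right ?_ hpos
      calc Real.exp (-7) * (A.card : ℝ) ^ k * (A.card : ℝ) ^ (2 * k + 1)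
          = Real.exp (-7) * (A.card : ℝ) ^ (3 * k + 1) := by ring
        _ ≤ _ := hloss
        _ = (A'.card : ℝ) ^ k * (A'.card : ℝ) ^ (2 * k + 1) := by ring
        _ ≤ (A'.card : ℝ) ^ k * (A.card : ℝ) ^ (2 * k + 1) := by
          gcongr; exact erase_subset _ _
    have h1 : Real.exp (-7) * min ((Fintype.card F : ℝ) * (A.card : ℝ) ^ k)
        ((A.card : ℝ) ^ (3 * k + 1) / (Fintype.card F : ℝ) ^ k)
        ≤ min ((Fintype.card F : ℝ) * (A'.card : ℝ) ^ k)
        ((A'.card : ℝ) ^ (3 * k + 1) / (Fintype.card F : ℝ) ^ k) := by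
      rw [mul_min_of_nonneg _ _ hc0.le]
      apply min_le_min
      · calc _ = (Fintype.card F : ℝ) * (Real.exp (-7) * (A.card : ℝ) ^ k) := by ring
          _ ≤ _ := by gcongr
      · rw [mul_div_assoc']
        gcongr
    have h2 : (P.card : ℝ) ^ k * ((DD A' (k + 1)).card : ℝ)
        ≤ (M.card : ℝ) ^ k * ((DD A (k + 1)).card : ℝ) := by
      have e1 : (P.card : ℝ) ≤ M.card := by
        have : P.card ≤ M.card := by omega
        exact_mod_cast this
      have e2 : ((DD A' (k + 1)).card : ℝ) ≤ (DD A (k + 1)).card := by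
        exact_mod_cast card_le_card (DD_subset (erase_subset _ _) _)
      exact mul_le_mul (pow_le_pow_left₀ (by positivity) e1 k) e2 (by positivity) (by positivity)
    linarith
  · push Not at hkn
    have hPA : A'.card ≤ P.card := by
      obtain ⟨a, ha⟩ := hne'
      refine card_le_card_of_injOn (fun b => a * b) (fun b hb => hmemP a ha b hb) ?_
      intro b _ c _ hbc
      exact mul_left_cancel₀ (ne_of_mem_erase ha) hbc
    obtain ⟨j, hj⟩ := Nat.exists_eq_add_of_le hPA
    have hb := big_d A P h0 hP hsmall (k + 1) j (by omega) hj
    have hb' : (Fintype.card F : ℝ) ≤ 32 * ((1 + j) * (DD A (k + 1)).card) := by exact_mod_cast hb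
    have hbern := bern A.card j k hN1 (by omega)
    have hMj : (A.card : ℝ) + j ≤ M.card := by
      have : A.card + j ≤ M.card := by omega
      exact_mod_cast this
    have h1 : (A.card : ℝ) ^ k * (1 + j) ≤ (M.card : ℝ) ^ k := hbern.trans (by gcongr)
    have h3 := min_le_left ((Fintype.card F : ℝ) * (A.card : ℝ) ^ k)
        ((A.card : ℝ) ^ (3 * k + 1) / (Fintype.card F : ℝ) ^ k)
    have h4 : 0 ≤ (Fintype.card F : ℝ) * (A.card : ℝ) ^ k := by positivity
    calc _ ≤ (Real.exp (-7) / 4) * ((Fintype.card F : ℝ) * (A.card : ℝ) ^ k) := by gcongr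
      _ ≤ (1 / 32) * ((Fintype.card F : ℝ) * (A.card : ℝ) ^ k) := by
          exact mul_le_mul_of_nonneg_right (by linarith) h4
      _ ≤ (1 / 32) * ((32 * ((1 + j) * (DD A (k + 1)).card)) * (A.card : ℝ) ^ k) := by gcongr
      _ = ((A.card : ℝ) ^ k * (1 + j)) * (DD A (k + 1)).card := by ring
      _ ≤ _ := by gcongr

end final

theorem stmt12 :
    ∃ c : ℝ, 0 < c ∧
      ∀ (F : Type) [Field F] [Fintype F] [DecidableEq F],
        Odd (Fintype.card F) →
        ∀ (d : ℕ), 2 ≤ d →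
        ∀ (A : Finset F),
          c * min ((Fintype.card F : ℝ) * (A.card : ℝ) ^ (d - 1))
              ((A.card : ℝ) ^ (3 * d - 2) / (Fintype.card F : ℝ) ^ (d - 1))
            ≤ (((A ×ˢ A).image (fun p => p.1 * p.2)).card : ℝ) ^ (d - 1)
              * (((Fintype.piFinset (fun _ : Fin d => A)).image
                    (fun f => ∑ i, f i)).card : ℝ) := by
  refine ⟨Real.exp (-7) / 4, by positivity, ?_⟩
  intro F _ _ _ _ d hd A
  obtain ⟨k, rfl⟩ : ∃ k, d = k + 1 := ⟨d - 1, by omega⟩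
  have h := final_aux A k (by omega)
  have e : 3 * (k + 1) - 2 = 3 * k + 1 := by omega
  rw [e]
  simpa only [DD, Nat.add_sub_cancel] using h
end
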